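/- Let q₁, …, q_m : ℝ → ℝ each satisfy (A1) q_i(0) = q_i(1) = 0, (A2) q_i is twice differentiable on [0,1], and (A3) q_i is strictly concave on [0,1], with h := min_i q_i'(0) > 0 and H := max_i q_i'(0). For c ∈ (0, h) let ū_i(c) ∈ (0,1) be the unique solution of q_i'(u)/(1 + q_i(u))² = c and L(c) := min_i ū_i(c). Then the equation c = (H/2)·L(c) has a unique solution c ∈ (0, h). -/

import Mathlib

/-- A strictly concave function vanishing at both ends of `[0,1]` is nonnegative there. -/
lemma StrictConcaveOn.nonneg_of_zero_of_one {f : ℝ → ℝ}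
    (hf : StrictConcaveOn ℝ (Set.Icc (0:ℝ) 1) f) (h0 : f 0 = 0) (h1 : f 1 = 0)
    {u : ℝ} (hu : u ∈ Set.Icc (0:ℝ) 1) : 0 ≤ f u := by
  have := hf.concaveOn.2 (Set.left_mem_Icc.2 zero_le_one) (Set.right_mem_Icc.2 zero_le_one)
    (sub_nonneg.2 hu.2) hu.1 (by ring)
  simpa [h0, h1] using this

/-- Where it is positive, `f' / (1 + f)²` is strictly decreasing, for `f` nonnegative and strictly
concave on `[0,1]`. -/
lemma StrictConcaveOn.deriv_div_one_add_sq_lt {f : ℝ → ℝ}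
    (hf : StrictConcaveOn ℝ (Set.Icc (0:ℝ) 1) f)
    (hnonneg : ∀ u ∈ Set.Icc (0:ℝ) 1, 0 ≤ f u)
    (hd : ∀ u ∈ Set.Icc (0:ℝ) 1, DifferentiableAt ℝ f u)
    {u v : ℝ} (hu : 0 ≤ u) (huv : u < v) (hv : v ≤ 1)
    (hpos : 0 < deriv f v / (1 + f v) ^ 2) :
    deriv f v / (1 + f v) ^ 2 < deriv f u / (1 + f u) ^ 2 := by
  have hu' : u ∈ Set.Icc (0:ℝ) 1 := ⟨hu, huv.le.trans hv⟩
  have hv' : v ∈ Set.Icc (0:ℝ) 1 := ⟨hu.trans huv.le, hv⟩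
  have hfu := hnonneg u hu'
  have hfv := hnonneg v hv'
  have hdv : 0 < deriv f v := (div_pos_iff_of_pos_right (by positivity)).1 hpos
  have hslope := hdv.trans (hf.deriv_lt_slope hu' hv' huv (hd v hv'))
  rw [slope_def_field, div_pos_iff_of_pos_right (sub_pos.2 huv), sub_pos] at hslope
  have hanti := hf.strictAntiOn_deriv hd hu' hv' huv
  calc deriv f v / (1 + f v) ^ 2 < deriv f u / (1 + f v) ^ 2 := by gcongr
    _ ≤ deriv f u / (1 + f u) ^ 2 := by
      have := hdv.trans hanti
      gcongr

/-- The graph of `f' / (1 + f)²` meets each line of positive slope through the origin over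
`(0,1)`. -/
lemma StrictConcaveOn.exists_deriv_div_one_add_sq_eq_mul {f : ℝ → ℝ}
    (hf : StrictConcaveOn ℝ (Set.Icc (0:ℝ) 1) f) (h0 : f 0 = 0) (h1 : f 1 = 0)
    (hd : ∀ u ∈ Set.Icc (0:ℝ) 1, DifferentiableAt ℝ f u)
    (hcont : ContinuousOn (deriv f) (Set.Icc (0:ℝ) 1))
    (hpos : 0 < deriv f 0) {a : ℝ} (ha : 0 < a) :
    ∃ u ∈ Set.Ioo (0:ℝ) 1, deriv f u / (1 + f u) ^ 2 = a * u := by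
  have hnonneg : ∀ u ∈ Set.Icc (0:ℝ) 1, 0 ≤ f u := fun u hu =>
    hf.nonneg_of_zero_of_one h0 h1 hu
  have hfc : ContinuousOn f (Set.Icc (0:ℝ) 1) := fun u hu =>
    (hd u hu).continuousAt.continuousWithinAt
  have hgc : ContinuousOn (fun u => deriv f u / (1 + f u) ^ 2 - a * u) (Set.Icc (0:ℝ) 1) := by
    refine (hcont.div ((continuousOn_const.add hfc).pow 2) fun u hu => ?_).sub (by fun_prop)
    exact pow_ne_zero 2 (add_pos_of_pos_of_nonneg one_pos (hnonneg u hu)).ne'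
  have hd1 : deriv f 1 < 0 := by
    have := hf.deriv_lt_slope (Set.left_mem_Icc.2 zero_le_one) (Set.right_mem_Icc.2 zero_le_one)
      zero_lt_one (hd 1 (Set.right_mem_Icc.2 zero_le_one))
    simpa [slope_def_field, h0, h1] using this
  obtain ⟨u, hu, hgu⟩ := intermediate_value_Ioo' zero_le_one hgc
    (show (0:ℝ) ∈ Set.Ioo _ _ by simp only [h0, h1, Set.mem_Ioo]; constructor <;> linarith)
  exact ⟨u, hu, sub_eq_zero.1 hgu⟩


/-- If each `q i` satisfies (A1)-(A3) with `h := min_i (q i)' 0 > 0` and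
`H := max_i (q i)' 0`, and for `c ∈ (0, h)`, `ubar i c ∈ (0,1)` is the unique
solution of `(q i)' u / (1 + q i u)^2 = c` with `L c := min_i (ubar i c)`, then
the equation `c = (H/2) * L c` has a unique solution `c ∈ (0, h)`. -/
theorem exists_unique_cstar {ι : Type*} [Fintype ι] [Nonempty ι]
    (q : ι → ℝ → ℝ)
    (hq0 : ∀ i, q i 0 = 0) (hq1 : ∀ i, q i 1 = 0)
    (hq2 : ∀ i, ∀ u ∈ Set.Icc (0:ℝ) 1,
      DifferentiableAt ℝ (q i) u ∧ DifferentiableAt ℝ (deriv (q i)) u)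
    (hqc : ∀ i, StrictConcaveOn ℝ (Set.Icc (0:ℝ) 1) (q i))
    (h H : ℝ)
    (hdef : h = Finset.univ.inf' Finset.univ_nonempty (fun i => deriv (q i) 0))
    (hHdef : H = Finset.univ.sup' Finset.univ_nonempty (fun i => deriv (q i) 0))
    (hpos : 0 < h)
    (ubar : ι → ℝ → ℝ)
    (hubar : ∀ i, ∀ c ∈ Set.Ioo (0:ℝ) h,
      ubar i c ∈ Set.Ioo (0:ℝ) 1 ∧
      deriv (q i) (ubar i c) / (1 + q i (ubar i c)) ^ 2 = c ∧
      ∀ u ∈ Set.Ioo (0:ℝ) 1, deriv (q i) u / (1 + q i u) ^ 2 = c → u = ubar i c)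
    (L : ℝ → ℝ)
    (hL : ∀ c, L c = Finset.univ.inf' Finset.univ_nonempty (fun i => ubar i c)) :
    ∃! c : ℝ, c ∈ Set.Ioo (0:ℝ) h ∧ c = H / 2 * L c := by
  have hd : ∀ i, ∀ u ∈ Set.Icc (0:ℝ) 1, DifferentiableAt ℝ (q i) u := fun i u hu => (hq2 i u hu).1
  have hanti : ∀ i, ∀ u v : ℝ, 0 ≤ u → u < v → v ≤ 1 → 0 < deriv (q i) v / (1 + q i v) ^ 2 →
      deriv (q i) v / (1 + q i v) ^ 2 < deriv (q i) u / (1 + q i u) ^ 2 := fun i u v =>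
    (hqc i).deriv_div_one_add_sq_lt (fun w hw => (hqc i).nonneg_of_zero_of_one (hq0 i) (hq1 i) hw)
      (hd i)
  have hle : ∀ i, h ≤ deriv (q i) 0 := fun i => hdef ▸ Finset.inf'_le _ (Finset.mem_univ i)
  have hH : 0 < H := by
    obtain ⟨i⟩ := ‹Nonempty ι›
    exact (hpos.trans_le (hle i)).trans_le
      (hHdef ▸ Finset.le_sup' (fun i => deriv (q i) 0) (Finset.mem_univ i))
  have hLanti : ∀ c ∈ Set.Ioo (0:ℝ) h, ∀ d ∈ Set.Ioo (0:ℝ) h, c < d → L d ≤ L c := by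
    intro c hc d hd' hcd
    rw [hL, hL]
    refine Finset.inf'_mono_fun fun i _ => ?_
    obtain ⟨huc, hgc, -⟩ := hubar i c hc
    obtain ⟨hud, hgd, -⟩ := hubar i d hd'
    by_contra! hlt
    have := hanti i _ _ huc.1.le hlt hud.2.le (hd'.1.trans_eq hgd.symm)
    rw [hgc, hgd] at this
    exact this.not_gt hcd
  have hnlt : ∀ c d, c ∈ Set.Ioo (0:ℝ) h ∧ c = H / 2 * L c →
      d ∈ Set.Ioo (0:ℝ) h ∧ d = H / 2 * L d → ¬ c < d := by
    rintro c d ⟨hc, hce⟩ ⟨hd', hde⟩ hcd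
    have := mul_le_mul_of_nonneg_left (hLanti c hc d hd' hcd) (half_pos hH).le
    linarith
  choose w hw hgw using fun i => (hqc i).exists_deriv_div_one_add_sq_eq_mul (hq0 i) (hq1 i) (hd i)
    (fun u hu => (hq2 i u hu).2.continuousAt.continuousWithinAt)
    (hpos.trans_le (hle i)) (half_pos hH)
  obtain ⟨k, -, hk⟩ := Finset.exists_min_image Finset.univ w Finset.univ_nonempty
  obtain ⟨j, -, hj⟩ := Finset.exists_mem_eq_inf' Finset.univ_nonempty (fun i => deriv (q i) 0)
  have hwpos : ∀ i, 0 < H / 2 * w i := fun i => mul_pos (half_pos hH) (hw i).1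
  have hc : H / 2 * w k ∈ Set.Ioo (0:ℝ) h := by
    refine ⟨hwpos k, ?_⟩
    have hlt := hanti j 0 (w j) le_rfl (hw j).1 (hw j).2.le (hgw j ▸ hwpos j)
    rw [hgw j, hq0 j, add_zero, one_pow, div_one, ← hj, ← hdef] at hlt
    exact (mul_le_mul_of_nonneg_left (hk j (Finset.mem_univ j)) (half_pos hH).le).trans_lt hlt
  have hLc : L (H / 2 * w k) = w k := by
    rw [hL]
    apply le_antisymm
    · exact (Finset.inf'_le _ (Finset.mem_univ k)).trans_eq
        ((hubar k _ hc).2.2 (w k) (hw k) (hgw k)).symm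
    · refine Finset.le_inf' _ _ fun i _ => ?_
      obtain ⟨hu, hgu, -⟩ := hubar i _ hc
      by_contra! hlt
      have hwk := hk i (Finset.mem_univ i)
      have hlt' := hanti i _ _ hu.1.le (hlt.trans_le hwk) (hw i).2.le (hgw i ▸ hwpos i)
      rw [hgu, hgw i] at hlt'
      exact (mul_le_mul_of_nonneg_left hwk (half_pos hH).le).not_gt hlt'
  refine ⟨H / 2 * w k, ⟨hc, by rw [hLc]⟩, fun d hd' => ?_⟩
  exact le_antisymm (not_lt.1 (hnlt _ _ ⟨hc, by rw [hLc]⟩ hd'))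
    (not_lt.1 (hnlt _ _ hd' ⟨hc, by rw [hLc]⟩))
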